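/- Let w ∈ ℂ∖{0} and x > 0. Then lim_{z→0, z≠0} [π e^{−w²/4} erfi²(w/2)/(z w²) − (√π·erfi(w/2)/(z·x^z·w))·₁F₁(1 − z/2; 3/2; −w²/4)] = C(iw)·log x + B(iw)/2, where C(iw) = (π/w²)·e^{−w²/4}·erfi²(w/2). -/

import Mathlib

noncomputable section
open Complex MeasureTheory Set Filter Topology

/-- Pochhammer symbol `(a)_n`. -/
def poch (a : ℂ) (n : ℕ) : ℂ := (ascPochhammer ℂ n).eval a

/-- Confluent hypergeometric function `₁F₁(a; c; z)`. -/
def oneF1 (a c z : ℂ) : ℂ := ∑' n : ℕ, poch a n / poch c n * z ^ n / (n.factorial : ℂ)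

/-- Complex error function, defined by integrating along the segment from `0` to `w`. -/
def cerf (w : ℂ) : ℂ :=
  (2 / (Real.sqrt Real.pi : ℂ)) * ∫ t in (0:ℝ)..1, w * Complex.exp (-(t * w) ^ 2)

/-- Complex imaginary error function. -/
def cerfi (w : ℂ) : ℂ :=
  (2 / (Real.sqrt Real.pi : ℂ)) * ∫ t in (0:ℝ)..1, w * Complex.exp ((t * w) ^ 2)

/-- Digamma function `ψ = Γ'/Γ`. -/
def digam (x : ℝ) : ℝ := deriv Real.Gamma x / Real.Gamma x

/-- The function `C(w) = (π/w²) e^{w²/4} erf²(w/2)`. -/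
def Cfun (w : ℂ) : ℂ := ((Real.pi : ℂ) / w ^ 2) * Complex.exp (w ^ 2 / 4) * (cerf (w / 2)) ^ 2

/-- The function `B(w)`. -/
def Bfun (w : ℂ) : ℂ := ((Real.sqrt Real.pi : ℂ) / w) * cerf (w / 2) *
  ∑' n : ℕ, (w ^ 2 / 4) ^ n / poch (3/2) n * ((digam (n + 1) : ℂ) + (Real.eulerMascheroniConstant : ℂ))


lemma poch_zero' (a : ℂ) : poch a 0 = 1 := by simp [poch]

lemma poch_succ' (a : ℂ) (n : ℕ) : poch a (n + 1) = poch a n * (a + n) := by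
  simp [poch, ascPochhammer_succ_eval]

lemma poch_one' (n : ℕ) : poch 1 n = (n.factorial : ℂ) := by
  induction n with
  | zero => simp [poch_zero']
  | succ k ih => rw [poch_succ', ih, Nat.factorial_succ]; push_cast; ring

lemma poch_deriv (n : ℕ) :
    HasDerivAt (fun a => poch a n) ((n.factorial : ℂ) * (harmonic n : ℂ)) 1 := by
  induction n with
  | zero => simpa [poch_zero'] using hasDerivAt_const (1 : ℂ) (1 : ℂ)
  | succ k ih =>
    have h := ih.mul ((hasDerivAt_id (1 : ℂ)).add_const (k : ℂ))
    have e : (fun a => poch a (k + 1)) = (fun a => poch a k) * (fun a => id a + (k : ℂ)) := by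
      funext a; simp [poch_succ']
    rw [e]
    refine h.congr_deriv ?_
    have hk : (k : ℂ) + 1 ≠ 0 := by exact_mod_cast Nat.succ_ne_zero k
    rw [harmonic_succ, poch_one', Nat.factorial_succ]
    push_cast
    simp only [id]
    field_simp
    ring

lemma poch_upper (a : ℂ) (ha : ‖a‖ ≤ 2) (n : ℕ) : ‖poch a n‖ ≤ ((n + 1).factorial : ℝ) := by
  induction n with
  | zero => simp [poch_zero']
  | succ k ih =>
    rw [poch_succ', norm_mul, Nat.factorial_succ (k + 1), mul_comm]
    push_cast
    have : ‖a + k‖ ≤ (k : ℝ) + 1 + 1 := by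
      refine (norm_add_le _ _).trans ?_
      simp; linarith
    gcongr

lemma poch_lower (n : ℕ) : (n.factorial : ℝ) ≤ ‖poch (3/2) n‖ := by
  induction n with
  | zero => simp [poch_zero']
  | succ k ih =>
    rw [poch_succ', norm_mul, Nat.factorial_succ, mul_comm]
    push_cast
    have : (k : ℝ) + 1 ≤ ‖(3/2 : ℂ) + k‖ := by
      have : (3/2 : ℂ) + k = ((3/2 + k : ℝ) : ℂ) := by push_cast; ring
      rw [this, Complex.norm_real, Real.norm_eq_abs, abs_of_nonneg (by positivity)]
      linarith
    gcongr

lemma poch_ne (n : ℕ) : poch (3/2) n ≠ 0 := by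
  have := poch_lower n
  have h2 : (0 : ℝ) < n.factorial := by positivity
  exact norm_pos_iff.1 (h2.trans_le this)

lemma oneF1_deriv (u : ℂ) :
    HasDerivAt (fun a => oneF1 a (3/2) u) (∑' n : ℕ, u ^ n / poch (3/2) n * (harmonic n : ℂ)) 1 := by
  have hd : ∀ i : ℕ, Differentiable ℂ
      (fun a => poch a i / poch (3/2) i * u ^ i / (i.factorial : ℂ)) := by
    intro i
    have : Differentiable ℂ (fun a => poch a i) := (ascPochhammer ℂ i).differentiable
    fun_prop
  have hu := Real.summable_pow_div_factorial (2 * ‖u‖)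
  have hb : ∀ (i : ℕ) (a : ℂ), a ∈ Metric.ball (1 : ℂ) 1 →
      ‖poch a i / poch (3/2) i * u ^ i / (i.factorial : ℂ)‖ ≤ (2 * ‖u‖) ^ i / i.factorial := by
    intro i a ha
    have ha2 : ‖a‖ ≤ 2 := by
      have : ‖a - 1‖ < 1 := by simpa [dist_eq_norm] using ha
      calc ‖a‖ = ‖(a - 1) + 1‖ := by ring_nf
        _ ≤ ‖a - 1‖ + ‖(1 : ℂ)‖ := norm_add_le _ _
        _ ≤ 2 := by simp; linarith
    have h1 := poch_upper a ha2 i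
    have h2 := poch_lower i
    have hf : (0 : ℝ) < i.factorial := by positivity
    have h3 : ‖poch a i / poch (3/2) i‖ ≤ 2 ^ i := by
      rw [norm_div, div_le_iff₀ (hf.trans_le h2)]
      refine h1.trans ?_
      rw [Nat.factorial_succ]
      push_cast
      have : (i : ℝ) + 1 ≤ 2 ^ i := by exact_mod_cast Nat.lt_two_pow_self
      gcongr
    rw [norm_div, norm_mul, norm_pow, mul_pow, Complex.norm_natCast]
    gcongr
  have hm : (1 : ℂ) ∈ Metric.ball (1 : ℂ) 1 := by simp
  have hs := Complex.hasSum_deriv_of_summable_norm hu (fun i => (hd i).differentiableOn)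
    Metric.isOpen_ball hb hm
  have hD := ((Complex.differentiableOn_tsum_of_summable_norm hu
    (fun i => (hd i).differentiableOn) Metric.isOpen_ball hb).differentiableAt
      (Metric.isOpen_ball.mem_nhds hm)).hasDerivAt
  have e : (∑' n : ℕ, u ^ n / poch (3/2) n * (harmonic n : ℂ)) =
      deriv (fun a : ℂ => ∑' i : ℕ, poch a i / poch (3/2) i * u ^ i / (i.factorial : ℂ)) 1 := by
    rw [← hs.tsum_eq]
    refine tsum_congr fun n => ?_
    have h := (((poch_deriv n).div_const (poch (3/2) n)).mul_const (u ^ n)).div_const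
      (n.factorial : ℂ)
    rw [h.deriv]
    have := poch_ne n
    have hf : (n.factorial : ℂ) ≠ 0 := by exact_mod_cast n.factorial_ne_zero
    field_simp
  rw [e]
  exact hD

lemma int_pow (n : ℕ) :
    ∫ t in (0:ℝ)..1, (1 - (t : ℂ) ^ 2) ^ n = (n.factorial : ℂ) / poch (3/2) n := by
  induction n with
  | zero => simp [poch_zero']
  | succ k ih =>
    have hder : ∀ t ∈ uIcc (0:ℝ) 1, HasDerivAt (fun t : ℝ => (t : ℂ) * (1 - (t : ℂ) ^ 2) ^ (k + 1))
        ((2 * k + 3) * (1 - (t : ℂ) ^ 2) ^ (k + 1) - 2 * (k + 1) * (1 - (t : ℂ) ^ 2) ^ k) t := by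
      intro t _
      have h1 : HasDerivAt (fun t : ℂ => t * (1 - t ^ 2) ^ (k + 1)) _ (t : ℂ) :=
        (hasDerivAt_id (t : ℂ)).mul
          ((((hasDerivAt_id (t : ℂ)).pow 2).const_sub 1).pow (k + 1))
      have h2 := h1.comp_ofReal
      convert h2 using 1
      simp
      ring
    have hc : ∀ m : ℕ, IntervalIntegrable (fun t : ℝ => (1 - (t : ℂ) ^ 2) ^ m) volume 0 1 :=
      fun m => Continuous.intervalIntegrable (by fun_prop) _ _
    have hF := intervalIntegral.integral_eq_sub_of_hasDerivAt hder
      (((hc (k + 1)).const_mul _).sub ((hc k).const_mul _))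
    rw [intervalIntegral.integral_sub ((hc (k + 1)).const_mul _) ((hc k).const_mul _),
      intervalIntegral.integral_const_mul, intervalIntegral.integral_const_mul, ih] at hF
    simp at hF
    have h3 : (2 * k + 3 : ℂ) ≠ 0 := by exact_mod_cast (by omega : 2 * k + 3 ≠ 0)
    have h4 : (3/2 + k : ℂ) ≠ 0 := by
      intro h; apply h3; linear_combination 2 * h
    have := poch_ne k
    apply mul_left_cancel₀ h3
    rw [sub_eq_zero.1 hF, poch_succ', Nat.factorial_succ]
    push_cast
    rw [mul_div_assoc', eq_comm, mul_div_assoc', div_eq_div_iff (mul_ne_zero this h4) this]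
    ring

lemma oneF1_one (u : ℂ) :
    oneF1 1 (3/2) u = Complex.exp u * ∫ t in (0:ℝ)..1, Complex.exp (-u * (t : ℂ) ^ 2) := by
  have hs : HasSum (fun n : ℕ => ∫ t in (0:ℝ)..1, (u * (1 - (t : ℂ) ^ 2)) ^ n / (n.factorial : ℂ))
      (∫ t in (0:ℝ)..1, Complex.exp (u * (1 - (t : ℂ) ^ 2))) := by
    refine intervalIntegral.hasSum_integral_of_dominated_convergence
      (fun n _ => ‖u‖ ^ n / n.factorial) ?_ ?_ ?_ ?_ ?_
    · intro n
      exact Continuous.aestronglyMeasurable (by fun_prop)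
    · intro n
      refine Eventually.of_forall fun t ht => ?_
      rw [uIoc_of_le zero_le_one] at ht
      have : ‖1 - (t : ℂ) ^ 2‖ ≤ 1 := by
        have e : 1 - (t : ℂ) ^ 2 = ((1 - t ^ 2 : ℝ) : ℂ) := by push_cast; ring
        rw [e, Complex.norm_real, Real.norm_eq_abs, abs_le]
        constructor <;> nlinarith [ht.1, ht.2]
      rw [norm_div, norm_pow, norm_mul, Complex.norm_natCast]
      gcongr
      exact mul_le_of_le_one_right (norm_nonneg _) this
    · exact Eventually.of_forall fun t _ => Real.summable_pow_div_factorial _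
    · exact Continuous.intervalIntegrable (by fun_prop) _ _
    · refine Eventually.of_forall fun t _ => ?_
      rw [Complex.exp_eq_exp_ℂ]
      exact NormedSpace.expSeries_div_hasSum_exp _
  rw [← intervalIntegral.integral_const_mul]
  have e : (fun t : ℝ => Complex.exp u * Complex.exp (-u * (t : ℂ) ^ 2)) =
      fun t : ℝ => Complex.exp (u * (1 - (t : ℂ) ^ 2)) := by
    funext t; rw [← Complex.exp_add]; ring_nf
  rw [e, ← hs.tsum_eq, oneF1]
  refine tsum_congr fun n => ?_
  simp_rw [mul_pow, mul_div_right_comm]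
  rw [intervalIntegral.integral_const_mul, int_pow, poch_one']
  ring

lemma cerf_I (w : ℂ) : cerf (I * w / 2) = I * cerfi (w / 2) := by
  unfold cerf cerfi
  rw [mul_left_comm, ← intervalIntegral.integral_const_mul I]
  congr 1
  refine intervalIntegral.integral_congr fun t _ => ?_
  have : -((t : ℂ) * (I * w / 2)) ^ 2 = ((t : ℂ) * (w / 2)) ^ 2 := by
    linear_combination (-(t:ℂ)^2 * w^2/4) * I_sq
  rw [this]; ring

lemma cerfi_J (w : ℂ) : (Real.sqrt Real.pi : ℂ) * cerfi (w / 2) =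
    w * ∫ t in (0:ℝ)..1, Complex.exp (-(-w ^ 2 / 4) * (t : ℂ) ^ 2) := by
  have hp : (Real.sqrt Real.pi : ℂ) ≠ 0 := by
    exact_mod_cast (Real.sqrt_pos.2 Real.pi_pos).ne'
  unfold cerfi
  rw [intervalIntegral.integral_const_mul]
  have : (fun t : ℝ => Complex.exp (((t : ℂ) * (w / 2)) ^ 2)) =
      fun t : ℝ => Complex.exp (-(-w ^ 2 / 4) * (t : ℂ) ^ 2) := by
    funext t; ring_nf
  rw [this]
  field_simp

lemma digam_nat (n : ℕ) : (digam (n + 1) : ℂ) + (Real.eulerMascheroniConstant : ℂ) =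
    (harmonic n : ℂ) := by
  have hf : (n.factorial : ℝ) ≠ 0 := by exact_mod_cast n.factorial_ne_zero
  have : digam (n + 1) = -Real.eulerMascheroniConstant + harmonic n := by
    rw [digam, Real.deriv_Gamma_nat, Real.Gamma_nat_eq_factorial]
    field_simp
  rw [this]; push_cast; ring

/-- The limit `L₂(w, α, m)` evaluated in the proof of Theorem 1.4 of Dixit–Kumar
(equation (2.15)), together with the identity `C(iw) = (π/w²) e^{-w²/4} erfi²(w/2)`. -/
theorem limit_L2 (w : ℂ) (hw : w ≠ 0) (x : ℝ) (hx : 0 < x) :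
    Cfun (I * w) = ((Real.pi : ℂ) / w ^ 2) * Complex.exp (-w ^ 2 / 4) * (cerfi (w / 2)) ^ 2 ∧
    Tendsto (fun z : ℂ =>
        (Real.pi : ℂ) * Complex.exp (-w ^ 2 / 4) * (cerfi (w / 2)) ^ 2 / (z * w ^ 2)
          - ((Real.sqrt Real.pi : ℂ) * cerfi (w / 2) / (z * (x:ℂ) ^ z * w))
              * oneF1 (1 - z / 2) (3/2) (-w ^ 2 / 4))
      (𝓝[≠] (0 : ℂ))
      (𝓝 (Cfun (I * w) * (Real.log x : ℂ) + Bfun (I * w) / 2)) := by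
  have hI : I ≠ 0 := I_ne_zero
  have hsq : (I * w) ^ 2 = -w ^ 2 := by rw [mul_pow, I_sq]; ring
  have hC : Cfun (I * w) =
      ((Real.pi : ℂ) / w ^ 2) * Complex.exp (-w ^ 2 / 4) * (cerfi (w / 2)) ^ 2 := by
    rw [Cfun, cerf_I, hsq, mul_pow, I_sq]
    field_simp
  refine ⟨hC, ?_⟩
  set u : ℂ := -w ^ 2 / 4 with hu
  set J : ℂ := ∫ t in (0:ℝ)..1, Complex.exp (-u * (t : ℂ) ^ 2) with hJ
  set H : ℂ := ∑' n : ℕ, u ^ n / poch (3/2) n * (harmonic n : ℂ) with hH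
  have hcJ : (Real.sqrt Real.pi : ℂ) * cerfi (w / 2) = w * J := cerfi_J w
  have hpi : (Real.pi : ℂ) = (Real.sqrt Real.pi : ℂ) ^ 2 := by
    exact_mod_cast (Real.sq_sqrt Real.pi_pos.le).symm
  have hpc : (Real.pi : ℂ) * cerfi (w / 2) ^ 2 = w ^ 2 * J ^ 2 := by
    rw [hpi, ← mul_pow, hcJ, mul_pow]
  have hG : oneF1 1 (3/2) u = Complex.exp u * J := oneF1_one u
  have hC' : Cfun (I * w) = J * (Complex.exp u * J) := by
    rw [hC]
    field_simp
    linear_combination hpc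
  have hB : Bfun (I * w) = J * H := by
    rw [Bfun, cerf_I, hsq]
    have : (∑' n : ℕ, (-w ^ 2 / 4) ^ n / poch (3/2) n *
        ((digam (n + 1) : ℂ) + (Real.eulerMascheroniConstant : ℂ))) = H := by
      rw [hH]
      exact tsum_congr fun n => by rw [digam_nat]
    rw [this]
    field_simp
    linear_combination H * hcJ
  have hx0 : (x : ℂ) ≠ 0 := by exact_mod_cast hx.ne'
  have hd1 : HasDerivAt (fun z : ℂ => oneF1 (1 - z / 2) (3/2) u) (H * (-(1 / 2))) 0 := by
    have h0 : HasDerivAt (fun z : ℂ => 1 - z / 2) (-(1 / 2)) 0 :=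
      ((hasDerivAt_id (0 : ℂ)).div_const 2).const_sub 1
    have h1 := oneF1_deriv u
    exact HasDerivAt.comp (0 : ℂ) (h₂ := fun a => oneF1 a (3/2) u) (by simpa using h1) h0
  have hd2 : HasDerivAt (fun z : ℂ => (x : ℂ) ^ (-z)) (-(Real.log x : ℂ)) 0 := by
    have h := (hasDerivAt_neg (0 : ℂ)).const_cpow (c := (x : ℂ)) (Or.inl hx0)
    simpa [Complex.ofReal_log hx.le] using h
  have hd := hd2.mul hd1
  have ht := (hasDerivAt_iff_tendsto_slope.1 hd).const_mul (-J)
  have hval : (-J) * (-(Real.log x : ℂ) * oneF1 (1 - 0 / 2) (3/2) u +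
      (x : ℂ) ^ (-(0:ℂ)) * (H * (-(1 / 2)))) =
      Cfun (I * w) * (Real.log x : ℂ) + Bfun (I * w) / 2 := by
    rw [hC', hB]
    simp [hG]
    ring
  rw [hval] at ht
  refine ht.congr' ?_
  filter_upwards [self_mem_nhdsWithin] with z hz
  have hz : z ≠ 0 := hz
  have hxz : (x : ℂ) ^ z ≠ 0 := by simp [Complex.cpow_eq_zero_iff, hx0]
  simp only [slope, vsub_eq_sub, smul_eq_mul, Pi.mul_apply, sub_zero, neg_zero, zero_div,
    Complex.cpow_zero, hG, Complex.cpow_neg]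
  have e1 : (Real.pi : ℂ) * Complex.exp u * cerfi (w / 2) ^ 2 = w ^ 2 * J ^ 2 * Complex.exp u := by
    linear_combination Complex.exp u * hpc
  rw [e1, hcJ]
  field_simp
  ring
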